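/- arXiv:2410.22019 — 2 statements merged into one kernel-verified Lean document; each statement's English description precedes it below -/
import Mathlib

section
/- Let N, t ≥ 1 and let H' be a 4-uniform hypergraph on vertex set {0, 1, ..., N−1} such that every set of t+1 vertices of H' contains 5 vertices all of whose 4-subsets are edges of H'. Define a 5-uniform hypergraph H on {0, 1, ..., 2^N − 1} by: a 5-tuple e = (a_1 < ... < a_5) is an edge of H if and only if either (I) m(e) = 0 (i.e., δ_1, δ_2, δ_3, δ_4 form a strictly monotone sequence) and {δ_1, δ_2, δ_3, δ_4} is an edge of H', or (II) m(e) = 2. Then every set of 4t^2 vertices of H contains 6 vertices all of whose 5-subsets are edges of H. -/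
/-- For distinct nonnegative integers `a` and `b`, `bdelta a b` is the largest index `i`
such that the `i`-th binary digits of `a` and `b` differ. -/
noncomputable def bdelta (a b : ℕ) : ℕ := sSup {i | a.testBit i ≠ b.testBit i}

/-- For a tuple `a 1 < a 2 < ⋯` of nonnegative integers, `dseq a i = δ(a i, a (i+1))`. -/
noncomputable def dseq (a : ℕ → ℕ) (i : ℕ) : ℕ := bdelta (a i) (a (i + 1))

/-- The index `i` is a local extremum of the δ-sequence of the tuple `a`:
`δ_{i-1} < δ_i > δ_{i+1}` or `δ_{i-1} > δ_i < δ_{i+1}`. -/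
def IsLocalExt (a : ℕ → ℕ) (i : ℕ) : Prop :=
  (dseq a (i - 1) < dseq a i ∧ dseq a (i + 1) < dseq a i) ∨
    (dseq a i < dseq a (i - 1) ∧ dseq a i < dseq a (i + 1))

open Classical in
/-- `numExtrema r a` is `m(e)`: the number of local extrema of the δ-sequence
`δ_1, …, δ_{r-1}` of an increasing `r`-tuple `e = (a 1, …, a r)`; the possible local extrema
are the indices `2 ≤ i ≤ r - 2`. -/
noncomputable def numExtrema (r : ℕ) (a : ℕ → ℕ) : ℕ :=
  ((Finset.Icc 2 (r - 2)).filter (fun i => IsLocalExt a i)).card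

/-- The δ-sequence `δ_1, …, δ_{r-1}` of the `r`-tuple `(a 1, …, a r)` is strictly monotone. -/
def DMonotone (r : ℕ) (a : ℕ → ℕ) : Prop :=
  (∀ i, 1 ≤ i → i + 1 ≤ r - 1 → dseq a i < dseq a (i + 1)) ∨
    (∀ i, 1 ≤ i → i + 1 ≤ r - 1 → dseq a (i + 1) < dseq a i)

theorem bdelta_spec {a b : ℕ} (h : a < b) :
    a.testBit (bdelta a b) = false ∧ b.testBit (bdelta a b) = true ∧
      ∀ j, bdelta a b < j → a.testBit j = b.testBit j := by
  have hne : {i | a.testBit i ≠ b.testBit i}.Nonempty := by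
    by_contra hcon
    rw [Set.not_nonempty_iff_eq_empty, Set.eq_empty_iff_forall_notMem] at hcon
    exact h.ne (Nat.eq_of_testBit_eq fun i => by simpa using hcon i)
  have hbd : BddAbove {i | a.testBit i ≠ b.testBit i} := by
    refine ⟨b, fun i hi => ?_⟩
    by_contra hlt
    have hb : b < 2 ^ i := lt_trans (not_le.1 hlt) Nat.lt_two_pow_self
    exact hi (by rw [Nat.testBit_lt_two_pow hb, Nat.testBit_lt_two_pow (h.trans hb)])
  have hmem : a.testBit (bdelta a b) ≠ b.testBit (bdelta a b) := Nat.sSup_mem hne hbd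
  have habove : ∀ j, bdelta a b < j → a.testBit j = b.testBit j := fun j hj => by
    by_contra hcon
    exact absurd (le_csSup hbd hcon) (not_le.2 hj)
  cases ha : a.testBit (bdelta a b) <;> cases hb : b.testBit (bdelta a b)
  · simp [ha, hb] at hmem
  · exact ⟨rfl, rfl, habove⟩
  · exact absurd (Nat.lt_of_testBit _ hb ha fun j hj => (habove j hj).symm) h.asymm
  · simp [ha, hb] at hmem

theorem bdelta_lt {a b N : ℕ} (h : a < b) (hb : b < 2 ^ N) : bdelta a b < N := by
  have h1 := Nat.ge_two_pow_of_testBit (bdelta_spec h).2.1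
  exact (Nat.pow_lt_pow_iff_right (by norm_num)).1 (h1.trans_lt hb)

theorem bdelta_ne {a b c : ℕ} (hab : a < b) (hbc : b < c) : bdelta a b ≠ bdelta b c := by
  intro h
  have h1 := (bdelta_spec hab).2.1
  have h2 := (bdelta_spec hbc).1
  simp [h, h2] at h1

theorem bdelta_eq_max {a b c : ℕ} (hab : a < b) (hbc : b < c) :
    bdelta a c = max (bdelta a b) (bdelta b c) := by
  obtain ⟨p1, p2, p3⟩ := bdelta_spec hab
  obtain ⟨q1, q2, q3⟩ := bdelta_spec hbc
  obtain ⟨r1, r2, r3⟩ := bdelta_spec (hab.trans hbc)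
  have hne := bdelta_ne hab hbc
  rcases lt_trichotomy (bdelta a c) (max (bdelta a b) (bdelta b c)) with h | h | h
  · exfalso
    have h3 := r3 _ h
    rcases lt_or_gt_of_ne hne with h' | h'
    · rw [max_eq_right h'.le, p3 _ h', q1, q2] at h3
      simp at h3
    · rw [max_eq_left h'.le, p1, ← q3 _ h', p2] at h3
      simp at h3
  · exact h
  · exfalso
    rw [p3 _ ((le_max_left _ _).trans_lt h), q3 _ ((le_max_right _ _).trans_lt h), r2] at r1
    simp at r1

theorem exists_five_of_card_eq {e : Finset ℕ} (he : e.card = 5) :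
    ∃ a b c d f, a < b ∧ b < c ∧ c < d ∧ d < f ∧ e = {a, b, c, d, f} := by
  have hlt : ∀ i j : Fin 5, i < j → e.orderEmbOfFin he i < e.orderEmbOfFin he j :=
    fun i j h => (e.orderEmbOfFin he).strictMono h
  refine ⟨_, _, _, _, _, hlt 0 1 (by decide), hlt 1 2 (by decide), hlt 2 3 (by decide),
    hlt 3 4 (by decide), ?_⟩
  ext x
  have h := Set.ext_iff.1 (e.range_orderEmbOfFin he) x
  rw [← Finset.mem_coe, ← h, Set.mem_range]
  simp only [Fin.exists_fin_succ, Finset.mem_insert, Finset.mem_singleton, eq_comm (a := x)]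
  simp

/-- Every vertex set has a vertex `z` such that, among the vertices to the left of `z` branching
off at one given level, all triples have increasing δ-sequence, and dually to the right. -/
theorem exists_spine {V : Finset ℕ} (hV : V.Nonempty)
    (hzig : ∀ u ∈ V, ∀ v ∈ V, ∀ w ∈ V, ∀ x ∈ V, ∀ y ∈ V, ∀ z ∈ V,
      u < v → v < w → w < x → x < y → y < z → bdelta v w < bdelta u v →
      bdelta u v < bdelta w x → bdelta x y < bdelta y z → bdelta w x ≤ bdelta y z) :
    ∃ z ∈ V,
      (∀ u ∈ V, ∀ v ∈ V, ∀ w ∈ V, u < v → v < w → w < z → bdelta u z = bdelta w z →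
        bdelta u v < bdelta v w) ∧
      (∀ u ∈ V, ∀ v ∈ V, ∀ w ∈ V, u < v → v < w → z < u → bdelta z u = bdelta z w →
        bdelta v w < bdelta u v) := by
  induction V using Finset.strongInduction with
  | H V ih =>
    set m := V.min' hV with hm
    set M := V.max' hV with hM
    have hmV : m ∈ V := V.min'_mem hV
    have hMV : M ∈ V := V.max'_mem hV
    have hle : ∀ u ∈ V, m ≤ u ∧ u ≤ M := fun u hu => ⟨V.min'_le u hu, V.le_max' u hu⟩
    rcases (hle m hmV).2.eq_or_lt with hmM | hmM
    · refine ⟨m, hmV, fun u hu v hv w hw huv hvw => ?_, fun u hu v hv w hw huv hvw => ?_⟩ <;>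
      · have := hle u hu
        have := hle w hw
        omega
    set D := bdelta m M with hD
    have hDle : ∀ u ∈ V, u < M → bdelta u M ≤ D := fun u hu huM => by
      rcases (hle u hu).1.eq_or_lt with h | h
      · rw [← h]
      · rw [hD, bdelta_eq_max h huM]
        exact le_max_right _ _
    set L := V.filter (fun u => u < M ∧ bdelta u M = D) with hL
    set R := V.filter (fun u => ¬ (u < M ∧ bdelta u M = D)) with hR
    have hLV : L ⊆ V := Finset.filter_subset _ _
    have hRV : R ⊆ V := Finset.filter_subset _ _
    have hmL : m ∈ L := Finset.mem_filter.2 ⟨hmV, hmM, rfl⟩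
    have hMR : M ∈ R := Finset.mem_filter.2 ⟨hMV, fun h => h.1.ne rfl⟩
    have hmR : m ∉ R := fun h => (Finset.mem_filter.1 h).2 ⟨hmM, rfl⟩
    have hML : M ∉ L := fun h => (Finset.mem_filter.1 h).2.1.ne rfl
    have hLR : ∀ u ∈ V, u ∈ L ∨ u ∈ R := fun u hu => by
      by_cases h : u < M ∧ bdelta u M = D
      · exact Or.inl (Finset.mem_filter.2 ⟨hu, h⟩)
      · exact Or.inr (Finset.mem_filter.2 ⟨hu, h⟩)
    have hLD : ∀ u ∈ L, u < M ∧ bdelta u M = D := fun u hu => (Finset.mem_filter.1 hu).2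
    have hRD : ∀ u ∈ R, u = M ∨ u < M ∧ bdelta u M < D := fun u hu => by
      obtain ⟨h1, h2⟩ := Finset.mem_filter.1 hu
      rcases (hle u h1).2.eq_or_lt with h | h
      · exact Or.inl h
      · have := hDle u h1 h
        exact Or.inr ⟨h, by omega⟩
    have hlt : ∀ u ∈ L, ∀ v ∈ R, u < v := fun u hu v hv => by
      obtain ⟨h1, h2⟩ := hLD u hu
      rcases hRD v hv with h | ⟨h3, h4⟩
      · omega
      · by_contra hcon
        rcases (not_lt.1 hcon).eq_or_lt with h | h
        · subst h; omega
        · have := bdelta_eq_max h h1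
          omega
    have hcross : ∀ u ∈ L, ∀ v ∈ R, bdelta u v = D := fun u hu v hv => by
      obtain ⟨h1, h2⟩ := hLD u hu
      rcases hRD v hv with h | ⟨h3, h4⟩
      · rw [h, h2]
      · have := bdelta_eq_max (hlt u hu v hv) h3
        omega
    have hLL : ∀ u ∈ L, ∀ v ∈ L, u < v → bdelta u v < D := fun u hu v hv huv => by
      obtain ⟨h1, h2⟩ := hLD u hu
      obtain ⟨h3, h4⟩ := hLD v hv
      have := bdelta_eq_max huv h3
      have := bdelta_ne huv h3
      omega
    have hRR : ∀ u ∈ R, ∀ v ∈ R, u < v → bdelta u v < D := fun u hu v hv huv => by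
      rcases hRD u hu with h1 | ⟨h1, h2⟩
      · have := (hle v (hRV hv)).2
        omega
      · rcases hRD v hv with h3 | ⟨h3, h4⟩
        · rwa [h3]
        · have := bdelta_eq_max huv h3
          omega
    have hRup : ∀ u ∈ R, ∀ v ∈ V, u < v → v ∈ R := fun u hu v hv huv =>
      (hLR v hv).resolve_left fun h => absurd (hlt v h u hu) huv.asymm
    have hLdown : ∀ u ∈ V, ∀ v ∈ L, u < v → u ∈ L := fun u hu v hv huv =>
      (hLR u hu).resolve_right fun h => absurd (hlt v hv u h) huv.asymm
    by_cases hdec : ∃ u ∈ L, ∃ v ∈ L, ∃ w ∈ L, u < v ∧ v < w ∧ bdelta v w < bdelta u v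
    · obtain ⟨u', hu', v', hv', w', hw', huv', hvw', hd'⟩ := hdec
      obtain ⟨z, hz, h1, h2⟩ := ih L ((Finset.ssubset_iff_of_subset hLV).2 ⟨M, hMV, hML⟩) ⟨m, hmL⟩
        (fun u hu v hv w hw x hx y hy z hz => hzig u (hLV hu) v (hLV hv) w (hLV hw) x (hLV hx)
          y (hLV hy) z (hLV hz))
      refine ⟨z, hLV hz, fun u hu v hv w hw huv hvw hwz => ?_,
        fun u hu v hv w hw huv hvw hzu heq => ?_⟩
      · have hw1 := hLdown w hw z hz hwz
        have hv1 := hLdown v hv w hw1 hvw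
        exact h1 u (hLdown u hu v hv1 huv) v hv1 w hw1 huv hvw hwz
      · rcases hLR w hw with hw1 | hw1
        · have hv1 := hLdown v hv w hw1 hvw
          exact h2 u (hLdown u hu v hv1 huv) v hv1 w hw1 huv hvw hzu heq
        · have hu1 : u ∈ R := (hLR u hu).resolve_left fun h => by
            have := hLL z hz u h hzu
            have := hcross z hz w hw1
            omega
          have hv1 := hRup u hu1 v hv huv
          have := hzig u' (hLV hu') v' (hLV hv') w' (hLV hw') u hu v hv w hw huv' hvw'
            (hlt _ hw' _ hu1) huv hvw hd'
          have := hcross w' hw' u hu1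
          have := hLL u' hu' v' hv' huv'
          have := hRR v hv1 w hw1 hvw
          have := bdelta_ne huv hvw
          omega
    · obtain ⟨z, hz, h1, h2⟩ := ih R ((Finset.ssubset_iff_of_subset hRV).2 ⟨m, hmV, hmR⟩) ⟨M, hMR⟩
        (fun u hu v hv w hw x hx y hy z hz => hzig u (hRV hu) v (hRV hv) w (hRV hw) x (hRV hx)
          y (hRV hy) z (hRV hz))
      refine ⟨z, hRV hz, fun u hu v hv w hw huv hvw hwz heq => ?_,
        fun u hu v hv w hw huv hvw hzu => ?_⟩
      · rcases hLR u hu with hu1 | hu1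
        · have hw1 : w ∈ L := (hLR w hw).resolve_right fun h => by
            have := hRR w h z hz hwz
            have := hcross u hu1 z hz
            omega
          by_contra hcon
          have := bdelta_ne huv hvw
          exact hdec ⟨u, hu1, v, hLdown v hv w hw1 hvw, w, hw1, huv, hvw, by omega⟩
        · have hv1 := hRup u hu1 v hv huv
          exact h1 u hu1 v hv1 w (hRup v hv1 w hw hvw) huv hvw hwz heq
      · have hu1 := hRup z hz u hu hzu
        have hv1 := hRup u hu1 v hv huv
        exact h2 u hu1 v hv1 w (hRup v hv1 w hw hvw) huv hvw hzu

/-- If every vertex sees at most `t` levels on each side and there is no zigzag on six vertices,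
then there are at most `2 * t ^ 2 + 1` vertices. -/
theorem card_le_of_levels {W : Finset ℕ} {t : ℕ} (hW : W.Nonempty)
    (hdec : ∀ z ∈ W, ((W.filter (· < z)).image (bdelta · z)).card ≤ t)
    (hinc : ∀ x ∈ W, ((W.filter (x < ·)).image (bdelta x)).card ≤ t)
    (hzig : ∀ u ∈ W, ∀ v ∈ W, ∀ w ∈ W, ∀ x ∈ W, ∀ y ∈ W, ∀ z ∈ W,
      u < v → v < w → w < x → x < y → y < z → bdelta v w < bdelta u v →
      bdelta u v < bdelta w x → bdelta x y < bdelta y z → bdelta w x ≤ bdelta y z) :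
    W.card ≤ 2 * t ^ 2 + 1 := by
  obtain ⟨z, hz, hl, hr⟩ := exists_spine hW hzig
  have hleft : (W.filter (· < z)).card ≤ t * t := by
    refine (Finset.card_le_mul_card_image (f := (bdelta · z)) _ t fun d hd => ?_).trans
      (Nat.mul_le_mul_left t (hdec z hz))
    set G := (W.filter (· < z)).filter (fun u => bdelta u z = d) with hG
    have hGm : ∀ u ∈ G, u ∈ W ∧ u < z ∧ bdelta u z = d := fun u hu => by
      simpa [hG, and_assoc] using hu
    have hGne : G.Nonempty := by
      obtain ⟨u, hu, hud⟩ := Finset.mem_image.1 hd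
      exact ⟨u, Finset.mem_filter.2 ⟨hu, hud⟩⟩
    set x := G.min' hGne with hx
    have hxG : x ∈ G := G.min'_mem hGne
    have hxlt : ∀ u ∈ G.erase x, x < u := fun u hu =>
      lt_of_le_of_ne (G.min'_le u (Finset.mem_of_mem_erase hu)) (Finset.ne_of_mem_erase hu).symm
    obtain ⟨hxW, hxz, hxd⟩ := hGm x hxG
    have hzG : z ∉ G.erase x := fun h => (hGm z (Finset.mem_of_mem_erase h)).2.1.ne rfl
    have hcard : (insert z (G.erase x)).card = G.card := by
      rw [Finset.card_insert_of_notMem hzG, Finset.card_erase_add_one hxG]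
    have hpair : ∀ u ∈ insert z (G.erase x), ∀ v ∈ insert z (G.erase x), u < v →
        bdelta x u ≠ bdelta x v := by
      intro u hu v hv huv
      rcases Finset.mem_insert.1 hu with rfl | hu
      · rcases Finset.mem_insert.1 hv with rfl | hv
        · exact absurd huv (lt_irrefl _)
        · exact absurd (hGm v (Finset.mem_of_mem_erase hv)).2.1 huv.asymm
      · have hxu := hxlt u hu
        obtain ⟨huW, huz, hud⟩ := hGm u (Finset.mem_of_mem_erase hu)
        have h1 := bdelta_eq_max hxu huv
        have h2 := bdelta_ne hxu huv
        rcases Finset.mem_insert.1 hv with rfl | hv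
        · omega
        · obtain ⟨hvW, hvz, hvd⟩ := hGm v (Finset.mem_of_mem_erase hv)
          have := hl x hxW u huW v hvW hxu huv hvz (by omega)
          omega
    rw [← hcard, ← Finset.card_image_of_injOn (f := bdelta x) (s := insert z (G.erase x))]
    · refine (Finset.card_le_card (Finset.image_subset_image fun u hu => ?_)).trans (hinc x hxW)
      rcases Finset.mem_insert.1 hu with rfl | hu
      · exact Finset.mem_filter.2 ⟨hz, hxz⟩
      · exact Finset.mem_filter.2 ⟨(hGm u (Finset.mem_of_mem_erase hu)).1, hxlt u hu⟩
    · intro u hu v hv huv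
      rcases lt_trichotomy u v with h | h | h
      · exact absurd huv (hpair u hu v hv h)
      · exact h
      · exact absurd huv.symm (hpair v hv u hu h)
  have hright : (W.filter (z < ·)).card ≤ t * t := by
    refine (Finset.card_le_mul_card_image (f := bdelta z) _ t fun d hd => ?_).trans
      (Nat.mul_le_mul_left t (hinc z hz))
    set G := (W.filter (z < ·)).filter (fun u => bdelta z u = d) with hG
    have hGm : ∀ u ∈ G, u ∈ W ∧ z < u ∧ bdelta z u = d := fun u hu => by
      simpa [hG, and_assoc] using hu
    have hGne : G.Nonempty := by
      obtain ⟨u, hu, hud⟩ := Finset.mem_image.1 hd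
      exact ⟨u, Finset.mem_filter.2 ⟨hu, hud⟩⟩
    set x := G.max' hGne with hx
    have hxG : x ∈ G := G.max'_mem hGne
    have hltx : ∀ u ∈ G.erase x, u < x := fun u hu =>
      lt_of_le_of_ne (G.le_max' u (Finset.mem_of_mem_erase hu)) (Finset.ne_of_mem_erase hu)
    obtain ⟨hxW, hzx, hxd⟩ := hGm x hxG
    have hzG : z ∉ G.erase x := fun h => (hGm z (Finset.mem_of_mem_erase h)).2.1.ne rfl
    have hcard : (insert z (G.erase x)).card = G.card := by
      rw [Finset.card_insert_of_notMem hzG, Finset.card_erase_add_one hxG]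
    have hpair : ∀ u ∈ insert z (G.erase x), ∀ v ∈ insert z (G.erase x), u < v →
        bdelta u x ≠ bdelta v x := by
      intro u hu v hv huv
      rcases Finset.mem_insert.1 hv with rfl | hv
      · rcases Finset.mem_insert.1 hu with rfl | hu
        · exact absurd huv (lt_irrefl _)
        · exact absurd (hGm u (Finset.mem_of_mem_erase hu)).2.1 huv.asymm
      · have hvx := hltx v hv
        obtain ⟨hvW, hzv, hvd⟩ := hGm v (Finset.mem_of_mem_erase hv)
        have h1 := bdelta_eq_max huv hvx
        have h2 := bdelta_ne huv hvx
        rcases Finset.mem_insert.1 hu with rfl | hu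
        · omega
        · obtain ⟨huW, hzu, hud⟩ := hGm u (Finset.mem_of_mem_erase hu)
          have := hr u huW v hvW x hxW huv hvx hzu (by omega)
          omega
    rw [← hcard, ← Finset.card_image_of_injOn (f := (bdelta · x)) (s := insert z (G.erase x))]
    · refine (Finset.card_le_card (Finset.image_subset_image fun u hu => ?_)).trans (hdec x hxW)
      rcases Finset.mem_insert.1 hu with rfl | hu
      · exact Finset.mem_filter.2 ⟨hz, hzx⟩
      · exact Finset.mem_filter.2 ⟨(hGm u (Finset.mem_of_mem_erase hu)).1, hltx u hu⟩
    · intro u hu v hv huv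
      rcases lt_trichotomy u v with h | h | h
      · exact absurd huv (hpair u hu v hv h)
      · exact h
      · exact absurd huv.symm (hpair v hv u hu h)
  have hsub : W ⊆ insert z (W.filter (· < z) ∪ W.filter (z < ·)) := fun u hu => by
    rcases lt_trichotomy u z with h | h | h <;> simp [hu, h]
  have h1 := Finset.card_le_card hsub
  have h2 := Finset.card_insert_le z (W.filter (· < z) ∪ W.filter (z < ·))
  have h3 := Finset.card_union_le (W.filter (· < z)) (W.filter (z < ·))
  nlinarith

theorem numExtrema_five_eq_two {a : ℕ → ℕ} (h2 : IsLocalExt a 2) (h3 : IsLocalExt a 3) :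
    numExtrema 5 a = 2 := by
  classical
  have h : (Finset.Icc 2 (5 - 2)).filter (fun i => IsLocalExt a i) = {2, 3} := by
    ext i
    simp only [Finset.mem_filter, Finset.mem_Icc, Finset.mem_insert, Finset.mem_singleton]
    constructor
    · rintro ⟨h, -⟩
      omega
    · rintro (rfl | rfl)
      · exact ⟨by omega, h2⟩
      · exact ⟨by omega, h3⟩
  unfold numExtrema
  exact (congrArg Finset.card (by convert h)).trans (Finset.card_pair (by norm_num : (2 : ℕ) ≠ 3))

/-- Five vertices as a sequence indexed from `1`. -/
def quint (a b c d f : ℕ) : ℕ → ℕ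
  | 1 => a
  | 2 => b
  | 3 => c
  | 4 => d
  | _ => f

theorem image_quint (a b c d f : ℕ) :
    (Finset.Icc 1 5).image (quint a b c d f) = {a, b, c, d, f} := by
  have h : Finset.Icc 1 5 = ({1, 2, 3, 4, 5} : Finset ℕ) := by decide
  simp [h, Finset.image_insert, quint]

theorem quint_lt {a b c d f : ℕ} (hab : a < b) (hbc : b < c) (hcd : c < d) (hdf : d < f) :
    ∀ i, 1 ≤ i → i < 5 → quint a b c d f i < quint a b c d f (i + 1) := by
  intro i h1 h2
  interval_cases i <;> assumption

theorem dMonotone_quint {a b c d f : ℕ}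
    (h : bdelta a b < bdelta b c ∧ bdelta b c < bdelta c d ∧ bdelta c d < bdelta d f ∨
      bdelta b c < bdelta a b ∧ bdelta c d < bdelta b c ∧ bdelta d f < bdelta c d) :
    DMonotone 5 (quint a b c d f) := by
  refine h.imp (fun h i h1 h2 => ?_) (fun h i h1 h2 => ?_) <;>
  · have : i ≤ 3 := by omega
    interval_cases i
    · exact h.1
    · exact h.2.1
    · exact h.2.2

theorem Finset.exists_eq_erase_of_card {S e : Finset ℕ} {n : ℕ} (h : e ⊆ S) (hS : S.card = n + 1)
    (he : e.card = n) : ∃ x ∈ S, e = S.erase x := by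
  have h1 : (S \ e).card = 1 := by
    rw [Finset.card_sdiff_of_subset h]
    omega
  obtain ⟨x, hx⟩ := Finset.card_eq_one.1 h1
  have hxS : x ∈ S \ e := by simp [hx]
  refine ⟨x, (Finset.mem_sdiff.1 hxS).1, ?_⟩
  rw [Finset.erase_eq, ← hx, Finset.sdiff_sdiff_eq_self h]

/-- Let `N, t ≥ 1` and let `E'` be a 4-uniform hypergraph on `{0,…,N-1}` such that every set
of `t+1` vertices contains 5 vertices all of whose 4-subsets are edges. Define a 5-uniform
hypergraph `E` on `{0,…,2^N - 1}` by: a 5-tuple `e = (a₁ < ⋯ < a₅)` is an edge iff (I) its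
δ-sequence `δ₁,δ₂,δ₃,δ₄` is strictly monotone (`m(e) = 0`) and `{δ₁,δ₂,δ₃,δ₄}` is an edge of
`E'`, or (II) `m(e) = 2`. Then every set of `4t²` vertices of `E` contains 6 vertices all of
whose 5-subsets are edges. -/
theorem stmt15 (N t : ℕ) (hN : 1 ≤ N) (ht : 1 ≤ t) (E' : Finset ℕ → Prop)
    (hE' : ∀ T ⊆ Finset.range N, T.card = t + 1 →
      ∃ S ⊆ T, S.card = 5 ∧ ∀ e ⊆ S, e.card = 4 → E' e)
    (E : Finset ℕ → Prop)
    (hE : ∀ a : ℕ → ℕ, (∀ i, 1 ≤ i → i < 5 → a i < a (i + 1)) → a 5 < 2 ^ N →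
      (E ((Finset.Icc 1 5).image a) ↔
        (DMonotone 5 a ∧ E' ({dseq a 1, dseq a 2, dseq a 3, dseq a 4} : Finset ℕ)) ∨
          numExtrema 5 a = 2)) :
    ∀ W ⊆ Finset.range (2 ^ N), W.card = 4 * t ^ 2 →
      ∃ S ⊆ W, S.card = 6 ∧ ∀ e ⊆ S, e.card = 5 → E e := by
  have hmono : ∀ a b c d f, a < b → b < c → c < d → d < f → f < 2 ^ N →
      (bdelta a b < bdelta b c ∧ bdelta b c < bdelta c d ∧ bdelta c d < bdelta d f ∨
        bdelta b c < bdelta a b ∧ bdelta c d < bdelta b c ∧ bdelta d f < bdelta c d) →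
      E' {bdelta a b, bdelta b c, bdelta c d, bdelta d f} → E {a, b, c, d, f} := by
    intro a b c d f hab hbc hcd hdf hf h he
    rw [← image_quint, hE _ (quint_lt hab hbc hcd hdf) hf]
    exact Or.inl ⟨dMonotone_quint h, he⟩
  have hext : ∀ a b c d f, a < b → b < c → c < d → d < f → f < 2 ^ N →
      (bdelta a b < bdelta b c ∧ bdelta c d < bdelta b c ∧ bdelta c d < bdelta d f ∨
        bdelta b c < bdelta a b ∧ bdelta b c < bdelta c d ∧ bdelta d f < bdelta c d) →
      E {a, b, c, d, f} := by
    intro a b c d f hab hbc hcd hdf hf h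
    rw [← image_quint, hE _ (quint_lt hab hbc hcd hdf) hf]
    refine Or.inr (numExtrema_five_eq_two ?_ ?_)
    · exact h.imp (fun h => ⟨h.1, h.2.1⟩) (fun h => ⟨h.1, h.2.1⟩)
    · exact h.symm.imp (fun h => ⟨h.2.1, h.2.2⟩) (fun h => ⟨h.2.1, h.2.2⟩)
  intro W hW hcard
  by_contra hno
  have hlt : ∀ u ∈ W, u < 2 ^ N := fun u hu => Finset.mem_range.1 (hW hu)
  have hfour : ∀ {S : Finset ℕ} {p q r s : ℕ}, (∀ e ⊆ S, e.card = 4 → E' e) →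
      p ∈ S → q ∈ S → r ∈ S → s ∈ S →
      (p < q ∧ q < r ∧ r < s ∨ q < p ∧ r < q ∧ s < r) → E' {p, q, r, s} := by
    intro S p q r s hS hp hq hr hs h
    refine hS _ (by simp [Finset.insert_subset_iff, *]) ?_
    rw [Finset.card_insert_of_notMem, Finset.card_insert_of_notMem, Finset.card_pair] <;>
      (try simp only [Finset.mem_insert, Finset.mem_singleton]) <;> omega
  have hdec : ∀ z ∈ W, ((W.filter (· < z)).image (bdelta · z)).card ≤ t := by
    intro z hz
    by_contra hcon
    obtain ⟨T, hT, hTc⟩ := Finset.exists_subset_card_eq (Nat.succ_le_of_lt (not_le.1 hcon))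
    obtain ⟨S, hST, hS5, hSE⟩ := hE' T (fun d hd => by
      obtain ⟨u, hu, rfl⟩ := Finset.mem_image.1 (hT hd)
      exact Finset.mem_range.2 (bdelta_lt (Finset.mem_filter.1 hu).2 (hlt z hz))) hTc
    obtain ⟨A, hA, hinj, hAS⟩ := Finset.exists_subset_injOn_image_eq_of_surjOn
      (W.filter (· < z) : Set ℕ) S (fun d hd => Finset.mem_image.1 (hT (hST hd)))
    have hAm : ∀ u ∈ A, u ∈ W ∧ u < z := fun u hu => Finset.mem_filter.1 (hA hu)
    have hzA : z ∉ A := fun h => (hAm z h).2.ne rfl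
    have hmem : ∀ u ∈ A, bdelta u z ∈ S := fun u hu =>
      hAS ▸ Finset.mem_image_of_mem (bdelta · z) hu
    have hA5 : A.card = 5 := by rw [← hS5, ← hAS, Finset.card_image_of_injOn hinj]
    have hsW : insert z A ⊆ W := Finset.insert_subset hz fun u hu => (hAm u hu).1
    refine hno ⟨insert z A, hsW, by rw [Finset.card_insert_of_notMem hzA, hA5], fun e he hec => ?_⟩
    obtain ⟨a, b, c, d, f, hab, hbc, hcd, hdf, rfl⟩ := exists_five_of_card_eq hec
    have hle : ∀ u ∈ insert z A, u ≤ z := fun u hu =>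
      (Finset.mem_insert.1 hu).elim (fun h => h.le) (fun h => (hAm u h).2.le)
    have hfm : f ∈ insert z A := he (by simp)
    have hfz := hle f hfm
    have hin : ∀ u ∈ insert z A, u < f → u ∈ A := fun u hu h =>
      (Finset.mem_insert.1 hu).resolve_left (by omega)
    have hstep : ∀ u ∈ insert z A, ∀ v ∈ insert z A, u < v → v < z →
        bdelta u v = bdelta u z ∧ bdelta v z < bdelta u z := by
      intro u hu v hv huv hvz
      have hne : bdelta u z ≠ bdelta v z := fun h => huv.ne
        (hinj ((Finset.mem_insert.1 hu).resolve_left (by omega))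
          ((Finset.mem_insert.1 hv).resolve_left (by omega)) h)
      have h1 := bdelta_eq_max huv hvz
      omega
    have ha := he (show a ∈ _ by simp)
    have hb := he (show b ∈ _ by simp)
    have hc := he (show c ∈ _ by simp)
    have hd := he (show d ∈ _ by simp)
    have h1 := hstep a ha b hb hab (by omega)
    have h2 := hstep b hb c hc hbc (by omega)
    have h3 := hstep c hc d hd hcd (by omega)
    have h4 : bdelta d f = bdelta d z := by
      rcases hfz.eq_or_lt with h | h
      · rw [h]
      · exact (hstep d hd f hfm hdf h).1
    have hchain : bdelta b c < bdelta a b ∧ bdelta c d < bdelta b c ∧ bdelta d f < bdelta c d := by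
      omega
    refine hmono a b c d f hab hbc hcd hdf (hlt f (hsW hfm)) (Or.inr hchain) ?_
    refine hfour hSE ?_ ?_ ?_ ?_ (Or.inr hchain)
    · exact h1.1 ▸ hmem a (hin a ha (by omega))
    · exact h2.1 ▸ hmem b (hin b hb (by omega))
    · exact h3.1 ▸ hmem c (hin c hc (by omega))
    · exact h4 ▸ hmem d (hin d hd (by omega))
  have hinc : ∀ x ∈ W, ((W.filter (x < ·)).image (bdelta x)).card ≤ t := by
    intro x hx
    by_contra hcon
    obtain ⟨T, hT, hTc⟩ := Finset.exists_subset_card_eq (Nat.succ_le_of_lt (not_le.1 hcon))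
    obtain ⟨S, hST, hS5, hSE⟩ := hE' T (fun d hd => by
      obtain ⟨u, hu, rfl⟩ := Finset.mem_image.1 (hT hd)
      obtain ⟨huW, hxu⟩ := Finset.mem_filter.1 hu
      exact Finset.mem_range.2 (bdelta_lt hxu (hlt u huW))) hTc
    obtain ⟨A, hA, hinj, hAS⟩ := Finset.exists_subset_injOn_image_eq_of_surjOn
      (W.filter (x < ·) : Set ℕ) S (fun d hd => Finset.mem_image.1 (hT (hST hd)))
    have hAm : ∀ u ∈ A, u ∈ W ∧ x < u := fun u hu => Finset.mem_filter.1 (hA hu)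
    have hxA : x ∉ A := fun h => (hAm x h).2.ne rfl
    have hmem : ∀ u ∈ A, bdelta x u ∈ S := fun u hu =>
      hAS ▸ Finset.mem_image_of_mem (bdelta x) hu
    have hA5 : A.card = 5 := by rw [← hS5, ← hAS, Finset.card_image_of_injOn hinj]
    have hsW : insert x A ⊆ W := Finset.insert_subset hx fun u hu => (hAm u hu).1
    refine hno ⟨insert x A, hsW, by rw [Finset.card_insert_of_notMem hxA, hA5], fun e he hec => ?_⟩
    obtain ⟨a, b, c, d, f, hab, hbc, hcd, hdf, rfl⟩ := exists_five_of_card_eq hec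
    have hle : ∀ u ∈ insert x A, x ≤ u := fun u hu =>
      (Finset.mem_insert.1 hu).elim (fun h => h.ge) (fun h => (hAm u h).2.le)
    have ha := he (show a ∈ _ by simp)
    have hb := he (show b ∈ _ by simp)
    have hc := he (show c ∈ _ by simp)
    have hd := he (show d ∈ _ by simp)
    have hf := he (show f ∈ _ by simp)
    have hxa := hle a ha
    have hin : ∀ u ∈ insert x A, a < u → u ∈ A := fun u hu h =>
      (Finset.mem_insert.1 hu).resolve_left (by omega)
    have hstep : ∀ u ∈ insert x A, ∀ v ∈ insert x A, x < u → u < v →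
        bdelta u v = bdelta x v ∧ bdelta x u < bdelta x v := by
      intro u hu v hv hxu huv
      have hne : bdelta x u ≠ bdelta x v := fun h => huv.ne
        (hinj ((Finset.mem_insert.1 hu).resolve_left (by omega))
          ((Finset.mem_insert.1 hv).resolve_left (by omega)) h)
      have h1 := bdelta_eq_max hxu huv
      omega
    have h2 := hstep b hb c hc (by omega) hbc
    have h3 := hstep c hc d hd (by omega) hcd
    have h4 := hstep d hd f hf (by omega) hdf
    have h1 : bdelta a b = bdelta x b := by
      rcases hxa.eq_or_lt with h | h
      · rw [h]
      · exact (hstep a ha b hb h hab).1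
    have hchain : bdelta a b < bdelta b c ∧ bdelta b c < bdelta c d ∧ bdelta c d < bdelta d f := by
      omega
    refine hmono a b c d f hab hbc hcd hdf (hlt f (hsW hf)) (Or.inl hchain) ?_
    refine hfour hSE ?_ ?_ ?_ ?_ (Or.inl hchain)
    · exact h1 ▸ hmem b (hin b hb (by omega))
    · exact h2.1 ▸ hmem c (hin c hc (by omega))
    · exact h3.1 ▸ hmem d (hin d hd (by omega))
    · exact h4.1 ▸ hmem f (hin f hf (by omega))
  have hW0 : W.Nonempty := Finset.card_pos.1 (by rw [hcard]; positivity)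
  have hfinal := card_le_of_levels hW0 hdec hinc (by
    intro u hu v hv w hw x hx y hy z hz huv hvw hwx hxy hyz h1 h2 h3
    by_contra h4
    refine hno ⟨{u, v, w, x, y, z}, by simp [Finset.insert_subset_iff, *], ?_, fun e he hec => ?_⟩
    · repeat rw [Finset.card_insert_of_notMem (by
        simp only [Finset.mem_insert, Finset.mem_singleton]; omega)]
      simp
    · have hS : ({u, v, w, x, y, z} : Finset ℕ).card = 6 := by
        repeat rw [Finset.card_insert_of_notMem (by
          simp only [Finset.mem_insert, Finset.mem_singleton]; omega)]
        simp
      have hz' := hlt z hz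
      have e1 := bdelta_eq_max huv hvw
      have e2 := bdelta_eq_max hvw hwx
      have e3 := bdelta_eq_max hwx hxy
      have e4 := bdelta_eq_max hxy hyz
      obtain ⟨s, hs, rfl⟩ := Finset.exists_eq_erase_of_card he hS hec
      have key : ∀ a b c d f, a < b → b < c → c < d → d < f → f < 2 ^ N →
          (bdelta a b < bdelta b c ∧ bdelta c d < bdelta b c ∧ bdelta c d < bdelta d f ∨
            bdelta b c < bdelta a b ∧ bdelta b c < bdelta c d ∧ bdelta d f < bdelta c d) →
          (∀ i, i ∈ ({u, v, w, x, y, z} : Finset ℕ).erase s ↔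
            i = a ∨ i = b ∨ i = c ∨ i = d ∨ i = f) →
          E (({u, v, w, x, y, z} : Finset ℕ).erase s) := by
        intro a b c d f hab hbc hcd hdf hf h hi
        have heq : ({u, v, w, x, y, z} : Finset ℕ).erase s = {a, b, c, d, f} := by
          ext i
          simpa using hi i
        exact heq ▸ hext a b c d f hab hbc hcd hdf hf h
      simp only [Finset.mem_insert, Finset.mem_singleton] at hs
      simp only [Finset.mem_erase, Finset.mem_insert, Finset.mem_singleton] at key
      obtain hs | hs | hs | hs | hs | hs := hs
      · exact key v w x y z hvw hwx hxy hyz hz' (by omega) (by omega)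
      · exact key u w x y z (by omega) hwx hxy hyz hz' (by omega) (by omega)
      · exact key u v x y z huv (by omega) hxy hyz hz' (by omega) (by omega)
      · exact key u v w y z huv hvw (by omega) hyz hz' (by omega) (by omega)
      · exact key u v w x z huv hvw hwx (by omega) hz' (by omega) (by omega)
      · exact key u v w x y huv hvw hwx hxy (by omega) (by omega) (by omega))
  have : 1 ≤ t ^ 2 := Nat.one_le_pow _ _ ht
  omega
end

section
/- Let k ≥ 7, N, t ≥ 1, and let H' be a (k−1)-uniform hypergraph on vertex set {0, 1, ..., N−1} such that every set of t+1 vertices of H' contains k vertices all of whose (k−1)-subsets are edges of H'. Define a k-uniform hypergraph H on {0, 1, ..., 2^N − 1} by: a k-tuple e = (a_1 < ... < a_k) is an edge of H if and only if either (I) m(e) = 0 and {δ_1, ..., δ_{k−1}} is an edge of H', or (II) m(e) = k−3, or (III) m(e) = k−4 and δ_1 < δ_2. Then every set of (k+2)t vertices of H contains k+1 vertices all of whose k-subsets are edges of H. -/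
theorem bdelta_lt_iff {x y : ℕ} (h : x ≠ y) (i : ℕ) :
    bdelta x y < i ↔ x / 2 ^ i = y / 2 ^ i := by
  have hb : BddAbove {i | x.testBit i ≠ y.testBit i} := by
    refine ⟨x + y, fun j hj => ?_⟩
    by_contra! hlt
    have h2 : j < 2 ^ j := Nat.lt_two_pow_self
    exact hj (by rw [Nat.testBit_lt_two_pow (by omega), Nat.testBit_lt_two_pow (by omega)])
  have hne : {i | x.testBit i ≠ y.testBit i}.Nonempty := by
    by_contra hemp
    rw [Set.not_nonempty_iff_eq_empty] at hemp
    refine h (Nat.eq_of_testBit_eq fun j => ?_)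
    by_contra hj
    have : j ∈ {i | x.testBit i ≠ y.testBit i} := hj
    simp [hemp] at this
  constructor
  · intro hlt
    refine Nat.eq_of_testBit_eq fun j => ?_
    rw [Nat.testBit_div_two_pow, Nat.testBit_div_two_pow]
    by_contra hj
    have : j + i ≤ bdelta x y := le_csSup hb hj
    omega
  · intro heq
    by_contra! hle
    have hmem : bdelta x y ∈ {i | x.testBit i ≠ y.testBit i} := Nat.sSup_mem hne hb
    refine hmem ?_
    obtain ⟨j, hj⟩ := Nat.exists_eq_add_of_le' hle
    rw [hj, ← Nat.testBit_div_two_pow, ← Nat.testBit_div_two_pow, heq]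

theorem bdelta_lt_of_lt_two_pow {x y n : ℕ} (h : x < y) (hy : y < 2 ^ n) : bdelta x y < n := by
  rw [bdelta_lt_iff h.ne, Nat.div_eq_of_lt hy, Nat.div_eq_of_lt (h.trans hy)]

theorem bdelta_eq_max_s17 {x y z : ℕ} (hxy : x < y) (hyz : y < z) :
    bdelta x z = max (bdelta x y) (bdelta y z) := by
  refine eq_of_forall_lt_iff fun i => ?_
  rw [← not_le, ← not_le, not_iff_not, ← Nat.lt_succ_iff, ← Nat.lt_succ_iff, max_lt_iff,
    bdelta_lt_iff hxy.ne, bdelta_lt_iff hyz.ne, bdelta_lt_iff (hxy.trans hyz).ne]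
  have h1 := Nat.div_le_div_right (c := 2 ^ i.succ) hxy.le
  have h2 := Nat.div_le_div_right (c := 2 ^ i.succ) hyz.le
  omega

theorem bdelta_ne_bdelta {x y z : ℕ} (hxy : x < y) (hyz : y < z) :
    bdelta x y ≠ bdelta y z := by
  intro h
  have h1 := (bdelta_lt_iff hxy.ne _).1 (Nat.lt_succ_self _)
  have h2 := (bdelta_lt_iff hyz.ne _).1 (Nat.lt_succ_self _)
  have h3 := mt (bdelta_lt_iff hxy.ne _).2 (lt_irrefl _)
  have h4 := mt (bdelta_lt_iff hyz.ne _).2 (lt_irrefl _)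
  rw [← h] at h2 h4
  have h5 := Nat.div_le_div_right (c := 2 ^ bdelta x y) hxy.le
  have h6 := Nat.div_le_div_right (c := 2 ^ bdelta x y) hyz.le
  rw [Nat.succ_eq_add_one, pow_succ, ← Nat.div_div_eq_div_mul, ← Nat.div_div_eq_div_mul] at h1 h2
  omega

theorem bdelta_lt_iff_forall_dseq_lt {w : ℕ → ℕ} (hw : StrictMono w) {i j : ℕ} (hij : i < j)
    (c : ℕ) : bdelta (w i) (w j) < c ↔ ∀ l, i ≤ l → l < j → dseq w l < c := by
  induction j, hij using Nat.le_induction with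
  | base =>
    constructor
    · intro h l h1 h2
      obtain rfl : l = i := by omega
      exact h
    · intro h
      exact h i le_rfl (Nat.lt_succ_self i)
  | succ j hij ih =>
    rw [bdelta_eq_max_s17 (hw hij) (hw (Nat.lt_succ_self j)), max_lt_iff, ih]
    constructor
    · rintro ⟨h1, h2⟩ l hl hlj
      rcases Nat.lt_succ_iff_lt_or_eq.1 hlj with h | rfl
      · exact h1 l hl h
      · exact h2
    · exact fun h => ⟨fun l h1 h2 => h l h1 (by omega), h j (by omega) (by omega)⟩

theorem dseq_le_bdelta {w : ℕ → ℕ} (hw : StrictMono w) {i j l : ℕ} (hi : i ≤ l) (hj : l < j) :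
    dseq w l ≤ bdelta (w i) (w j) :=
  Nat.lt_succ_iff.1
    ((bdelta_lt_iff_forall_dseq_lt hw (hi.trans_lt hj) _).1 (Nat.lt_succ_self _) l hi hj)

theorem bdelta_eq_dseq {w : ℕ → ℕ} (hw : StrictMono w) {i j m : ℕ} (hi : i ≤ m) (hj : m < j)
    (h : ∀ l, i ≤ l → l < j → dseq w l ≤ dseq w m) : bdelta (w i) (w j) = dseq w m :=
  le_antisymm
    (Nat.lt_succ_iff.1 ((bdelta_lt_iff_forall_dseq_lt hw (hi.trans_lt hj) _).2
      fun l h1 h2 => Nat.lt_succ_iff.2 (h l h1 h2)))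
    (dseq_le_bdelta hw hi hj)

theorem dseq_ne_dseq_succ {w : ℕ → ℕ} (hw : StrictMono w) (i : ℕ) :
    dseq w i ≠ dseq w (i + 1) :=
  bdelta_ne_bdelta (hw (Nat.lt_succ_self i)) (hw (Nat.lt_succ_self _))

theorem exists_strictMono_image_range (s : Finset ℕ) :
    ∃ c : ℕ → ℕ, StrictMono c ∧ (Finset.range s.card).image c = s := by
  set M := s.sup id + 1 with hM
  have hsM : ∀ x ∈ s, x < M := fun x hx => Nat.lt_succ_iff.2 (Finset.le_sup (f := id) hx)
  let p : ℕ → Prop := fun x => x ∈ s ∨ M ≤ x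
  have hp : {x | p x}.Infinite :=
    Set.infinite_of_forall_exists_gt fun x => ⟨x + 1 + M, Or.inr (by omega), by omega⟩
  classical
  have hcount : Nat.count p M = s.card := by
    rw [Nat.count_eq_card_filter_range]
    congr 1
    ext x
    simp only [Finset.mem_filter, Finset.mem_range, p]
    constructor
    · rintro ⟨h1, h2 | h2⟩
      · exact h2
      · omega
    · exact fun h => ⟨hsM x h, Or.inl h⟩
  refine ⟨Nat.nth p, Nat.nth_strictMono hp, Finset.eq_of_subset_of_card_le ?_ ?_⟩
  · intro x hx
    obtain ⟨i, hi, rfl⟩ := Finset.mem_image.1 hx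
    rw [Finset.mem_range, ← hcount] at hi
    have h1 := Nat.nth_lt_of_lt_count hi
    have h2 : p (Nat.nth p i) := Nat.nth_mem_of_infinite hp i
    exact h2.resolve_right (by omega)
  · rw [Finset.card_image_of_injective _ (Nat.nth_strictMono hp).injective, Finset.card_range]

theorem image_Icc_one_comp_pred (c : ℕ → ℕ) (k : ℕ) :
    (Finset.Icc 1 k).image (fun i => c (i - 1)) = (Finset.range k).image c := by
  ext x
  simp only [Finset.mem_image, Finset.mem_Icc, Finset.mem_range]
  constructor
  · rintro ⟨i, hi, rfl⟩
    exact ⟨i - 1, by omega, rfl⟩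
  · rintro ⟨i, hi, rfl⟩
    exact ⟨i + 1, by omega, rfl⟩

/-- Removing one vertex from a tuple with an alternating δ-sequence that starts with an ascent
leaves at most one index that is not a local extremum. -/
theorem numExtrema_of_alternating {k j : ℕ} {b c : ℕ → ℕ} (hk : 7 ≤ k) (hj1 : 1 ≤ j)
    (hjk : j ≤ k + 1) (hb : ∀ i, 1 ≤ i → i ≤ k → b i < b (i + 1))
    (hodd : ∀ i, 1 ≤ i → i + 1 ≤ k → i % 2 = 1 → dseq b i < dseq b (i + 1))
    (heven : ∀ i, 1 ≤ i → i + 1 ≤ k → i % 2 = 0 → dseq b (i + 1) < dseq b i)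
    (hc : c = fun i => if i < j then b i else b (i + 1)) :
    numExtrema k c = k - 3 ∨ (numExtrema k c = k - 4 ∧ dseq c 1 < dseq c 2) := by
  classical
  have hlow : ∀ i, i + 1 < j → dseq c i = dseq b i := by
    intro i hi
    simp only [dseq, hc, if_pos hi, if_pos (show i < j by omega)]
  have hhigh : ∀ i, j ≤ i → dseq c i = dseq b (i + 1) := by
    intro i hi
    simp only [dseq, hc, if_neg (show ¬ i < j by omega), if_neg (show ¬ i + 1 < j by omega)]
  have hmid : ∀ i, i + 1 = j → 1 ≤ i → i + 1 ≤ k →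
      dseq c i = max (dseq b i) (dseq b (i + 1)) := by
    intro i hi h1 h2
    simp only [dseq, hc, if_pos (show i < j by omega), if_neg (show ¬ i + 1 < j by omega)]
    exact bdelta_eq_max_s17 (hb i h1 (by omega)) (hb (i + 1) (by omega) h2)
  obtain ⟨s, hs1, hsk, hs, hcl, hch⟩ : ∃ s, 1 ≤ s ∧ s ≤ k ∧ (s % 2 = 1 ∨ s = k) ∧
      (∀ i, 1 ≤ i → i < s → i ≤ k - 1 → dseq c i = dseq b i) ∧
      (∀ i, s ≤ i → i ≤ k - 1 → dseq c i = dseq b (i + 1)) := by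
    rcases Nat.eq_or_lt_of_le hjk with rfl | hjk'
    · exact ⟨k, by omega, le_rfl, Or.inr rfl, fun i _ h _ => hlow i (by omega),
        fun i _ _ => by omega⟩
    rcases Nat.mod_two_eq_zero_or_one j with h | h
    · refine ⟨j - 1, by omega, by omega, Or.inl (by omega), fun i _ h _ => hlow i (by omega),
        fun i h1 h2 => ?_⟩
      rcases Nat.lt_or_ge i j with h3 | h3
      · rw [hmid i (by omega) (by omega) (by omega)]
        exact max_eq_right (hodd i (by omega) (by omega) (by omega)).le
      · exact hhigh i h3
    · refine ⟨j, by omega, by omega, Or.inl h, fun i h0 h1 h2 => ?_, fun i h1 h2 => hhigh i h1⟩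
      rcases Nat.eq_or_lt_of_le (show i + 1 ≤ j from h1) with h3 | h3
      · rw [hmid i h3 h0 (by omega)]
        exact max_eq_left (heven i h0 (by omega) (by omega)).le
      · exact hlow i h3
  have hbext : ∀ i, 2 ≤ i → i + 1 ≤ k → IsLocalExt b i := by
    intro i h1 h2
    obtain ⟨i, rfl⟩ := Nat.exists_eq_add_of_le' (show 1 ≤ i by omega)
    rcases Nat.mod_two_eq_zero_or_one i with h | h
    · exact Or.inr ⟨heven i (by omega) (by omega) h, hodd (i + 1) (by omega) h2 (by omega)⟩
    · exact Or.inl ⟨hodd i (by omega) (by omega) h, heven (i + 1) (by omega) h2 (by omega)⟩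
  have hext_low : ∀ i, 2 ≤ i → i ≤ k - 2 → i + 1 < s → IsLocalExt c i := by
    intro i h1 h2 h3
    have := hbext i h1 (by omega)
    rwa [IsLocalExt, ← hcl i (by omega) (by omega) (by omega),
      ← hcl (i + 1) (by omega) (by omega) (by omega),
      ← hcl (i - 1) (by omega) (by omega) (by omega)] at this
  have hext_high : ∀ i, 2 ≤ i → i ≤ k - 2 → s < i → IsLocalExt c i := by
    intro i h1 h2 h3
    have := hbext (i + 1) (by omega) (by omega)
    rwa [IsLocalExt, show i + 1 - 1 = i - 1 + 1 by omega,
      ← hch i (by omega) (by omega), ← hch (i + 1) (by omega) (by omega),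
      ← hch (i - 1) (by omega) (by omega)] at this
  have hall : (∀ i ∈ Finset.Icc 2 (k - 2), IsLocalExt c i) → numExtrema k c = k - 3 := by
    intro h
    rw [numExtrema, Finset.filter_true_of_mem h, Nat.card_Icc]
    omega
  rcases Nat.eq_or_lt_of_le hs1 with rfl | hs1'
  · refine Or.inl (hall fun i hi => ?_)
    rw [Finset.mem_Icc] at hi
    exact hext_high i hi.1 hi.2 (by omega)
  rcases Nat.eq_or_lt_of_le hsk with rfl | hsk'
  · refine Or.inl (hall fun i hi => ?_)
    rw [Finset.mem_Icc] at hi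
    exact hext_low i hi.1 hi.2 (by omega)
  have hs' : s % 2 = 1 := by omega
  obtain ⟨x, hx⟩ : ∃ x, ∀ i, 2 ≤ i → i ≤ k - 2 → i ≠ x → IsLocalExt c i := by
    obtain ⟨r, rfl⟩ := Nat.exists_eq_add_of_le' hs1'.le
    have hr1 := heven r (by omega) (by omega) (by omega)
    have hr2 := hodd (r + 1) (by omega) (by omega) (by omega)
    have hne : dseq b r ≠ dseq b (r + 2) := by
      have h1 := bdelta_eq_max_s17 (hb r (by omega) (by omega)) (hb (r + 1) (by omega) (by omega))
      have h2 : bdelta (b r) (b (r + 2)) = dseq b r := h1.trans (max_eq_left hr1.le)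
      rw [← h2]
      exact bdelta_ne_bdelta ((hb r (by omega) (by omega)).trans (hb (r + 1) (by omega) (by omega)))
        (hb (r + 2) (by omega) (by omega))
    rcases lt_or_gt_of_ne hne with hlt | hlt
    · refine ⟨r, fun i h1 h2 h3 => ?_⟩
      rcases lt_trichotomy i (r + 1) with h | rfl | h
      · exact hext_low i h1 h2 (by omega)
      · left
        rw [hch (r + 1) le_rfl (by omega), hch (r + 1 + 1) (by omega) (by omega),
          hcl (r + 1 - 1) (by omega) (by omega) (by omega)]
        exact ⟨hlt, heven (r + 2) (by omega) (by omega) (by omega)⟩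
      · exact hext_high i h1 h2 h
    · refine ⟨r + 1, fun i h1 h2 h3 => ?_⟩
      rcases lt_trichotomy i r with h | rfl | h
      · exact hext_low i h1 h2 (by omega)
      · left
        rw [hch (i + 1) le_rfl (by omega), hcl i (by omega) (by omega) (by omega),
          hcl (i - 1) (by omega) (by omega) (by omega)]
        refine ⟨?_, hlt⟩
        have := hodd (i - 1) (by omega) (by omega) (by omega)
        rwa [show i - 1 + 1 = i by omega] at this
      · exact hext_high i h1 h2 (by omega)
  have hge : k - 4 ≤ numExtrema k c := by
    have hsub : (Finset.Icc 2 (k - 2)).erase x ⊆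
        {i ∈ Finset.Icc 2 (k - 2) | IsLocalExt c i} := by
      intro i hi
      rw [Finset.mem_erase, Finset.mem_Icc] at hi
      exact Finset.mem_filter.2 ⟨Finset.mem_Icc.2 hi.2, hx i hi.2.1 hi.2.2 hi.1⟩
    have h1 := Finset.card_le_card hsub
    have h2 := Finset.pred_card_le_card_erase (s := Finset.Icc 2 (k - 2)) (a := x)
    rw [Nat.card_Icc] at h2
    have h3 : k - 4 ≤ ((Finset.Icc 2 (k - 2)).erase x).card := by omega
    exact h3.trans h1
  have hle : numExtrema k c ≤ k - 3 := by
    refine (Finset.card_filter_le _ _).trans ?_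
    rw [Nat.card_Icc]
    omega
  have h12 : dseq c 1 < dseq c 2 := by
    rw [hcl 1 le_rfl (by omega) (by omega), hcl 2 (by omega) (by omega) (by omega)]
    exact hodd 1 le_rfl (by omega) rfl
  rcases Nat.eq_or_lt_of_le hle with h | h
  · exact Or.inl h
  · exact Or.inr ⟨by omega, h12⟩

/-- If no `t + 1` consecutive entries of the δ-sequence are strictly monotone, every block of
`2 * t` vertices contains a local minimum of the δ-sequence, where the very first index counts
as a local minimum as soon as it is followed by an ascent. -/
theorem exists_valley {w : ℕ → ℕ} (hw : StrictMono w) {t m p : ℕ} (ht : 2 ≤ t)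
    (hpm : p + 2 * t ≤ m)
    (hinc : ∀ q, q + t + 1 < m → ∃ i, q ≤ i ∧ i < q + t ∧ ¬ dseq w i < dseq w (i + 1))
    (hdec : ∀ q, q + t + 1 < m → ∃ i, q ≤ i ∧ i < q + t ∧ ¬ dseq w (i + 1) < dseq w i) :
    ∃ q, p ≤ q ∧ q + 2 < p + 2 * t ∧ dseq w q < dseq w (q + 1) ∧
      (1 ≤ q → dseq w q < dseq w (q - 1)) := by
  classical
  obtain ⟨i, hi1, hi2, hi3⟩ := hdec (p + t - 2) (by omega)
  have hlt : dseq w i < dseq w (i + 1) :=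
    lt_of_le_of_ne (not_lt.1 hi3) (dseq_ne_dseq_succ hw i)
  have hex : ∃ q, p ≤ q ∧ ∀ l, q ≤ l → l ≤ i → dseq w l < dseq w (l + 1) :=
    ⟨i, by omega, fun l h1 h2 => by obtain rfl : l = i := by omega
                                    exact hlt⟩
  obtain ⟨hq1, hq2⟩ := Nat.find_spec hex
  have hmin := fun l => Nat.find_min (m := l) hex
  set q := Nat.find hex
  have hqi : q ≤ i := Nat.find_min' hex
    ⟨by omega, fun l h1 h2 => by obtain rfl : l = i := by omega
                                 exact hlt⟩
  refine ⟨q, hq1, by omega, hq2 q le_rfl hqi, fun h0 => ?_⟩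
  by_contra hcon
  have hq0 : dseq w (q - 1) < dseq w q := by
    refine lt_of_le_of_ne (not_lt.1 hcon) ?_
    have := dseq_ne_dseq_succ hw (q - 1)
    rwa [show q - 1 + 1 = q by omega] at this
  have hext : ∀ l, q - 1 ≤ l → l ≤ i → dseq w l < dseq w (l + 1) := by
    intro l h1 h2
    rcases Nat.eq_or_lt_of_le h1 with rfl | h
    · rwa [show q - 1 + 1 = q by omega]
    · exact hq2 l (by omega) h2
  rcases Nat.eq_or_lt_of_le hq1 with hpq | hpq
  · obtain ⟨l, hl1, hl2, hl3⟩ := hinc (q - 1) (by omega)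
    exact hl3 (hext l hl1 (by omega))
  · exact hmin (q - 1) (by omega) ⟨by omega, hext⟩

/-- If no `t + 1` consecutive entries of the δ-sequence are strictly monotone, one can choose
`k + 1` vertices whose δ-sequence alternates and starts with an ascent. -/
theorem exists_alternating {w : ℕ → ℕ} (hw : StrictMono w) {k t m : ℕ} (ht : 2 ≤ t)
    (hm : (k + 2) * t ≤ m)
    (hinc : ∀ q, q + t + 1 < m → ∃ i, q ≤ i ∧ i < q + t ∧ ¬ dseq w i < dseq w (i + 1))
    (hdec : ∀ q, q + t + 1 < m → ∃ i, q ≤ i ∧ i < q + t ∧ ¬ dseq w (i + 1) < dseq w i) :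
    ∃ b : ℕ → ℕ, (∀ i, 1 ≤ i → i ≤ k + 1 → ∃ l < m, b i = w l) ∧
      (∀ i, 1 ≤ i → i ≤ k → b i < b (i + 1)) ∧
      (∀ i, 1 ≤ i → i + 1 ≤ k → i % 2 = 1 → dseq b i < dseq b (i + 1)) ∧
      (∀ i, 1 ≤ i → i + 1 ≤ k → i % 2 = 0 → dseq b (i + 1) < dseq b i) := by
  have hblock : ∀ j, ∃ q, 2 * j ≤ k → 2 * t * j ≤ q ∧ q + 2 < 2 * t * j + 2 * t ∧
      dseq w q < dseq w (q + 1) ∧ (1 ≤ q → dseq w q < dseq w (q - 1)) := by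
    intro j
    by_cases hj : 2 * j ≤ k
    · have hbd : 2 * t * j + 2 * t ≤ m := by nlinarith
      obtain ⟨q, hq⟩ := exists_valley hw ht hbd hinc hdec
      exact ⟨q, fun _ => hq⟩
    · exact ⟨0, fun h => absurd h hj⟩
  choose v hv using hblock
  have hvm : ∀ j, 2 * j ≤ k → v j + 2 < m := by
    intro j hj
    have hbd : 2 * t * j + 2 * t ≤ m := by nlinarith
    have := (hv j hj).2.1
    omega
  have hsep : ∀ j, 2 * (j + 1) ≤ k → v j + 2 < v (j + 1) := by
    intro j hj
    have h1 := (hv j (by omega)).2.1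
    have h2 := (hv (j + 1) hj).1
    rw [mul_add, mul_one] at h2
    omega
  let f : ℕ → ℕ := fun i => v ((i - 1) / 2) + (i - 1) % 2
  have hf1 : ∀ j, f (2 * j + 1) = v j := by
    intro j
    simp only [f, show (2 * j + 1 - 1) / 2 = j by omega, show (2 * j + 1 - 1) % 2 = 0 by omega,
      add_zero]
  have hf2 : ∀ j, f (2 * j + 1 + 1) = v j + 1 := by
    intro j
    simp only [f, show (2 * j + 1 + 1 - 1) / 2 = j by omega,
      show (2 * j + 1 + 1 - 1) % 2 = 1 by omega]
  have hf3 : ∀ j, f (2 * j + 1 + 1 + 1) = v (j + 1) := fun j => hf1 (j + 1)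
  have hd1 : ∀ j, dseq (w ∘ f) (2 * j + 1) = dseq w (v j) := by
    intro j
    simp only [dseq, Function.comp_apply, hf1, hf2]
  have hd2 : ∀ j, dseq (w ∘ f) (2 * j + 1 + 1) = bdelta (w (v j + 1)) (w (v (j + 1))) := by
    intro j
    simp only [dseq, Function.comp_apply, hf2, hf3]
  refine ⟨w ∘ f, fun i h1 h2 => ⟨f i, ?_, rfl⟩, fun i h1 h2 => hw ?_, fun i h1 h2 h3 => ?_,
    fun i h1 h2 h3 => ?_⟩
  · have := hvm ((i - 1) / 2) (by omega)
    simp only [f]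
    omega
  · rcases Nat.mod_two_eq_zero_or_one i with h | h
    · obtain ⟨j, rfl⟩ : ∃ j, i = 2 * j + 1 + 1 := ⟨(i - 2) / 2, by omega⟩
      rw [hf2, hf3]
      have := hsep j (by omega)
      omega
    · obtain ⟨j, rfl⟩ : ∃ j, i = 2 * j + 1 := ⟨(i - 1) / 2, by omega⟩
      rw [hf1, hf2]
      omega
  · obtain ⟨j, rfl⟩ : ∃ j, i = 2 * j + 1 := ⟨(i - 1) / 2, by omega⟩
    rw [hd1, hd2]
    have hs : 2 * (j + 1) ≤ k := by omega
    exact (hv j (by omega)).2.2.1.trans_le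
      (dseq_le_bdelta hw le_rfl (by have := hsep j hs; omega))
  · obtain ⟨j, rfl⟩ : ∃ j, i = 2 * j + 1 + 1 := ⟨(i - 2) / 2, by omega⟩
    rw [hd2, show 2 * j + 1 + 1 + 1 = 2 * (j + 1) + 1 by ring, hd1]
    have hs := hsep j (by omega)
    exact ((hv (j + 1) (by omega)).2.2.2 (by omega)).trans_le
      (dseq_le_bdelta hw (by omega) (by omega))

/-- Subsets of size `k` of an alternating tuple are obtained by dropping one vertex. -/
theorem exists_eq_image_drop {k : ℕ} {b : ℕ → ℕ} {e : Finset ℕ}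
    (he : e ⊆ (Finset.Icc 1 (k + 1)).image b) (hcard : e.card = k)
    (hbi : Set.InjOn b (Finset.Icc 1 (k + 1))) :
    ∃ j, 1 ≤ j ∧ j ≤ k + 1 ∧
      e = (Finset.Icc 1 k).image (fun i => if i < j then b i else b (i + 1)) := by
  obtain ⟨J, hJ, rfl⟩ := Finset.subset_image_iff.1 he
  rw [Finset.card_image_of_injOn (hbi.mono hJ)] at hcard
  have hJ' : J ⊆ Finset.Icc 1 (k + 1) := by exact_mod_cast hJ
  obtain ⟨j, hj, hjJ⟩ : ∃ j ∈ Finset.Icc 1 (k + 1), j ∉ J := by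
    by_contra! h
    have := Finset.card_le_card h
    rw [Nat.card_Icc] at this
    omega
  have hJe : J = (Finset.Icc 1 (k + 1)).erase j := by
    refine Finset.eq_of_subset_of_card_le (Finset.subset_erase.2 ⟨hJ', hjJ⟩) ?_
    rw [Finset.card_erase_of_mem hj, Nat.card_Icc]
    omega
  rw [Finset.mem_Icc] at hj
  refine ⟨j, hj.1, hj.2, ?_⟩
  rw [hJe]
  ext x
  simp only [Finset.mem_image, Finset.mem_erase, Finset.mem_Icc]
  constructor
  · rintro ⟨i, ⟨h1, h2⟩, rfl⟩
    rcases lt_or_gt_of_ne h1 with h | h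
    · exact ⟨i, by omega, if_pos h⟩
    · refine ⟨i - 1, by omega, ?_⟩
      rw [if_neg (by omega), show i - 1 + 1 = i by omega]
  · rintro ⟨i, h1, rfl⟩
    split_ifs with h
    · exact ⟨i, by omega, rfl⟩
    · exact ⟨i + 1, by omega, rfl⟩

/-- If the δ-values at the index set `I` form a clique of `E'` and the δ-sequence is strictly
monotone on `I`, then the vertices with indices in `V` form a clique of `E`. Here `g x y ∈ I` is
an index at which the δ-sequence attains `bdelta (w x) (w y)`. -/
theorem exists_clique_of_monotone {k N : ℕ} (hk : 7 ≤ k) {E' E : Finset ℕ → Prop}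
    (hE : ∀ a : ℕ → ℕ, (∀ i, 1 ≤ i → i < k → a i < a (i + 1)) → a k < 2 ^ N →
      (E ((Finset.Icc 1 k).image a) ↔
        (DMonotone k a ∧ E' ((Finset.Icc 1 (k - 1)).image (dseq a))) ∨
          numExtrema k a = k - 3 ∨
          (numExtrema k a = k - 4 ∧ dseq a 1 < dseq a 2)))
    {w : ℕ → ℕ} (hw : StrictMono w) {V I : Finset ℕ} (hVN : ∀ v ∈ V, w v < 2 ^ N)
    (hI : ∀ e ⊆ I.image (dseq w), e.card = k - 1 → E' e) (g : ℕ → ℕ → ℕ)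
    (hgI : ∀ x ∈ V, ∀ y ∈ V, x < y → g x y ∈ I)
    (hgd : ∀ x ∈ V, ∀ y ∈ V, x < y → bdelta (w x) (w y) = dseq w (g x y))
    (hg : ∀ x ∈ V, ∀ y ∈ V, ∀ z ∈ V, x < y → y < z → g x y < g y z)
    (hmono : StrictMonoOn (dseq w) I ∨ StrictAntiOn (dseq w) I) :
    ∀ e ⊆ V.image w, e.card = k → E e := by
  intro e he hcard
  obtain ⟨J, hJ, rfl⟩ := Finset.subset_image_iff.1 he
  have hJV : ∀ x ∈ J, x ∈ V := fun x hx => by exact_mod_cast hJ hx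
  rw [Finset.card_image_of_injective _ hw.injective] at hcard
  obtain ⟨c, hc, hcJ⟩ := exists_strictMono_image_range J
  rw [hcard] at hcJ
  have hcV : ∀ i < k, c i ∈ V := fun i hi =>
    hJV _ (hcJ ▸ Finset.mem_image_of_mem c (Finset.mem_range.2 hi))
  have himg : J.image w = (Finset.Icc 1 k).image (fun i => w (c (i - 1))) := by
    rw [image_Icc_one_comp_pred (fun i => w (c i)), ← hcJ, Finset.image_image]
    rfl
  rw [himg, hE _ (fun i h1 h2 => hw (hc (by omega))) (hVN _ (hcV _ (by omega)))]
  have hdc : ∀ i, 1 ≤ i → i ≤ k - 1 →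
      dseq (fun i => w (c (i - 1))) i = dseq w (g (c (i - 1)) (c i)) := fun i h1 h2 =>
    hgd _ (hcV _ (by omega)) _ (hcV _ (by omega)) (hc (by omega))
  have hcI : ∀ i, 1 ≤ i → i ≤ k - 1 → g (c (i - 1)) (c i) ∈ I := fun i h1 h2 =>
    hgI _ (hcV _ (by omega)) _ (hcV _ (by omega)) (hc (by omega))
  have hstep : ∀ i, 1 ≤ i → i + 1 ≤ k - 1 →
      g (c (i - 1)) (c i) < g (c (i + 1 - 1)) (c (i + 1)) := fun i h1 h2 =>
    hg _ (hcV _ (by omega)) _ (hcV _ (by omega)) _ (hcV _ (by omega)) (hc (by omega))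
      (hc (by omega))
  have hlt : ∀ i j, 1 ≤ i → i < j → j ≤ k - 1 → g (c (i - 1)) (c i) < g (c (j - 1)) (c j) := by
    intro i j h1 h2
    induction j, h2 using Nat.le_induction with
    | base => exact fun h => hstep i h1 h
    | succ j hj ih => exact fun h => (ih (by omega)).trans (hstep j (by omega) h)
  have hinj : Set.InjOn (dseq w) I := hmono.elim (fun h => h.injOn) fun h => h.injOn
  refine Or.inl ⟨?_, hI _ ?_ ?_⟩
  · refine hmono.imp (fun h i h1 h2 => ?_) fun h i h1 h2 => ?_
    · rw [hdc i h1 (by omega), hdc (i + 1) (by omega) h2]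
      exact h (hcI i h1 (by omega)) (hcI (i + 1) (by omega) h2) (hstep i h1 h2)
    · rw [hdc i h1 (by omega), hdc (i + 1) (by omega) h2]
      exact h (hcI i h1 (by omega)) (hcI (i + 1) (by omega) h2) (hstep i h1 h2)
  · intro x hx
    obtain ⟨i, hi, rfl⟩ := Finset.mem_image.1 hx
    rw [Finset.mem_Icc] at hi
    rw [hdc i hi.1 hi.2]
    exact Finset.mem_image_of_mem _ (hcI i hi.1 hi.2)
  · rw [Finset.card_image_of_injOn, Nat.card_Icc, Nat.add_sub_cancel]
    intro i hi j hj hij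
    simp only [Finset.coe_Icc, Set.mem_Icc] at hi hj
    rw [hdc i hi.1 hi.2, hdc j hj.1 hj.2] at hij
    have h := hinj (hcI i hi.1 hi.2) (hcI j hj.1 hj.2) hij
    rcases lt_trichotomy i j with h' | h' | h'
    · exact absurd h (hlt i j hi.1 h' hj.2).ne
    · exact h'
    · exact absurd h.symm (hlt j i hj.1 h' hi.2).ne

/-- A stretch of `t + 1` consecutive strictly monotone entries of the δ-sequence carries an index
set of size `k` whose δ-values form a clique of `E'`. -/
theorem exists_index_clique {k N t p m : ℕ} {E' : Finset ℕ → Prop}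
    (hE' : ∀ T ⊆ Finset.range N, T.card = t + 1 →
      ∃ S ⊆ T, S.card = k ∧ ∀ e ⊆ S, e.card = k - 1 → E' e)
    {w : ℕ → ℕ} (hw : StrictMono w) (hwN : ∀ i < m, w i < 2 ^ N) (hp : p + t + 1 < m)
    (hinj : Set.InjOn (dseq w) (Finset.Icc p (p + t))) :
    ∃ I ⊆ Finset.Icc p (p + t), I.card = k ∧
      ∀ e ⊆ I.image (dseq w), e.card = k - 1 → E' e := by
  obtain ⟨S, hS, hScard, hSE⟩ := hE' ((Finset.Icc p (p + t)).image (dseq w))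
    (by
      intro x hx
      obtain ⟨i, hi, rfl⟩ := Finset.mem_image.1 hx
      rw [Finset.mem_Icc] at hi
      exact Finset.mem_range.2
        (bdelta_lt_of_lt_two_pow (hw (Nat.lt_succ_self i)) (hwN _ (by omega))))
    (by
      rw [Finset.card_image_of_injOn hinj, Nat.card_Icc]
      omega)
  obtain ⟨I, hI, rfl⟩ := Finset.subset_image_iff.1 hS
  rw [Finset.card_image_of_injOn (hinj.mono hI)] at hScard
  exact ⟨I, by exact_mod_cast hI, hScard, hSE⟩

theorem strictMonoOn_Icc_of_lt_succ {f : ℕ → ℕ} {p t : ℕ}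
    (h : ∀ i, p ≤ i → i < p + t → f i < f (i + 1)) :
    StrictMonoOn f (Finset.Icc p (p + t)) := by
  intro i hi j hj hij
  simp only [Finset.coe_Icc, Set.mem_Icc] at hi hj
  have hj2 := hj.2
  clear hj
  induction j, hij using Nat.le_induction with
  | base => exact h i hi.1 (by omega)
  | succ j hj ih => exact (ih (by omega)).trans (h j (by omega) (by omega))

theorem strictAntiOn_Icc_of_succ_lt {f : ℕ → ℕ} {p t : ℕ}
    (h : ∀ i, p ≤ i → i < p + t → f (i + 1) < f i) :
    StrictAntiOn f (Finset.Icc p (p + t)) := by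
  intro i hi j hj hij
  simp only [Finset.coe_Icc, Set.mem_Icc] at hi hj
  have hj2 := hj.2
  clear hj
  induction j, hij using Nat.le_induction with
  | base => exact h i hi.1 (by omega)
  | succ j hj ih => exact (h j (by omega) (by omega)).trans (ih (by omega))

/-- Let `k ≥ 7`, `N, t ≥ 1`, and let `E'` be a `(k-1)`-uniform hypergraph on `{0,…,N-1}` such
that every set of `t+1` vertices contains `k` vertices all of whose `(k-1)`-subsets are edges.
Define a `k`-uniform hypergraph `E` on `{0,…,2^N - 1}` by: a `k`-tuple `e = (a₁ < ⋯ < a_k)` is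
an edge iff (I) `m(e) = 0` (its δ-sequence is strictly monotone) and `{δ₁,…,δ_{k-1}}` is an
edge of `E'`, or (II) `m(e) = k - 3`, or (III) `m(e) = k - 4` and `δ₁ < δ₂`.
Then every set of `(k+2)t` vertices of `E` contains `k+1` vertices all of whose `k`-subsets
are edges. -/
theorem stmt17 (k N t : ℕ) (hk : 7 ≤ k) (hN : 1 ≤ N) (ht : 1 ≤ t) (E' : Finset ℕ → Prop)
    (hE' : ∀ T ⊆ Finset.range N, T.card = t + 1 →
      ∃ S ⊆ T, S.card = k ∧ ∀ e ⊆ S, e.card = k - 1 → E' e)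
    (E : Finset ℕ → Prop)
    (hE : ∀ a : ℕ → ℕ, (∀ i, 1 ≤ i → i < k → a i < a (i + 1)) → a k < 2 ^ N →
      (E ((Finset.Icc 1 k).image a) ↔
        (DMonotone k a ∧ E' ((Finset.Icc 1 (k - 1)).image (dseq a))) ∨
          numExtrema k a = k - 3 ∨
          (numExtrema k a = k - 4 ∧ dseq a 1 < dseq a 2))) :
    ∀ W ⊆ Finset.range (2 ^ N), W.card = (k + 2) * t →
      ∃ S ⊆ W, S.card = k + 1 ∧ ∀ e ⊆ S, e.card = k → E e := by
  intro W hW hWcard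
  obtain ⟨w, hw, hwW⟩ := exists_strictMono_image_range W
  rw [hWcard] at hwW
  set m := (k + 2) * t with hm
  have hmem : ∀ i < m, w i ∈ W := fun i hi =>
    hwW ▸ Finset.mem_image_of_mem w (Finset.mem_range.2 hi)
  have hwN : ∀ i < m, w i < 2 ^ N := fun i hi => Finset.mem_range.1 (hW (hmem i hi))
  by_cases hinc : ∃ q, q + t + 1 < m ∧ ∀ i, q ≤ i → i < q + t → dseq w i < dseq w (i + 1)
  · obtain ⟨p, hp, hmono⟩ := hinc
    have hmono := strictMonoOn_Icc_of_lt_succ hmono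
    obtain ⟨I, hI, hIcard, hIE⟩ := exists_index_clique hE' hw hwN hp hmono.injOn
    have hIb : ∀ x ∈ I, p ≤ x ∧ x ≤ p + t := fun x hx => Finset.mem_Icc.1 (hI hx)
    have hIne : I.Nonempty := Finset.card_pos.1 (by omega)
    set V := insert (I.min' hIne) (I.image (· + 1)) with hV
    have hVb : ∀ x ∈ V, x ≤ p + t + 1 ∧ I.min' hIne ≤ x ∧ (I.min' hIne < x → x - 1 ∈ I) := by
      intro x hx
      rcases Finset.mem_insert.1 hx with rfl | hx
      · exact ⟨by have := hIb _ (I.min'_mem hIne); omega, le_rfl, fun h => absurd h (lt_irrefl _)⟩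
      · obtain ⟨y, hy, rfl⟩ := Finset.mem_image.1 hx
        exact ⟨by have := hIb y hy; omega, (I.min'_le y hy).trans (Nat.le_succ y), fun _ => hy⟩
    have hminI := hIb _ (I.min'_mem hIne)
    refine ⟨V.image w, ?_, ?_, exists_clique_of_monotone hk hE hw
      (fun v hv => hwN v (by have := (hVb v hv).1; omega)) hIE (fun _ y => y - 1)
      (fun x hx y hy hxy => (hVb y hy).2.2 ((hVb x hx).2.1.trans_lt hxy)) ?_
      (fun x _ y _ z _ h1 h2 => by omega) (Or.inl (hmono.mono (by exact_mod_cast hI)))⟩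
    · intro x hx
      obtain ⟨v, hv, rfl⟩ := Finset.mem_image.1 hx
      exact hmem v (by have := (hVb v hv).1; omega)
    · rw [Finset.card_image_of_injective _ hw.injective, Finset.card_insert_of_notMem,
        Finset.card_image_of_injective _ (add_left_injective 1), hIcard]
      intro h
      obtain ⟨y, hy, hy'⟩ := Finset.mem_image.1 h
      have := I.min'_le y hy
      omega
    · intro x hx y hy hxy
      have h1 := hVb x hx
      have h2 := hVb y hy
      refine bdelta_eq_dseq hw (by omega) (by omega) fun l hl1 hl2 => hmono.monotoneOn ?_ ?_ ?_
      · simp only [Finset.coe_Icc, Set.mem_Icc]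
        omega
      · simp only [Finset.coe_Icc, Set.mem_Icc]
        omega
      · omega
  by_cases hdec : ∃ q, q + t + 1 < m ∧ ∀ i, q ≤ i → i < q + t → dseq w (i + 1) < dseq w i
  · obtain ⟨p, hp, hanti⟩ := hdec
    have hanti := strictAntiOn_Icc_of_succ_lt hanti
    obtain ⟨I, hI, hIcard, hIE⟩ := exists_index_clique hE' hw hwN hp hanti.injOn
    have hIb : ∀ x ∈ I, p ≤ x ∧ x ≤ p + t := fun x hx => Finset.mem_Icc.1 (hI hx)
    have hIne : I.Nonempty := Finset.card_pos.1 (by omega)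
    have hmaxI := hIb _ (I.max'_mem hIne)
    set V := insert (I.max' hIne + 1) I with hV
    have hVb : ∀ x ∈ V, p ≤ x ∧ x ≤ I.max' hIne + 1 ∧ (x < I.max' hIne + 1 → x ∈ I) := by
      intro x hx
      rcases Finset.mem_insert.1 hx with rfl | hx
      · exact ⟨by omega, le_rfl, fun h => absurd h (lt_irrefl _)⟩
      · exact ⟨(hIb x hx).1, (I.le_max' x hx).trans (Nat.le_succ _), fun _ => hx⟩
    refine ⟨V.image w, ?_, ?_, exists_clique_of_monotone hk hE hw
      (fun v hv => hwN v (by have := (hVb v hv).2.1; omega)) hIE (fun x _ => x)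
      (fun x hx y hy hxy => (hVb x hx).2.2 (hxy.trans_le (hVb y hy).2.1)) ?_
      (fun x _ y _ z _ h1 h2 => h1) (Or.inr (hanti.mono (by exact_mod_cast hI)))⟩
    · intro x hx
      obtain ⟨v, hv, rfl⟩ := Finset.mem_image.1 hx
      exact hmem v (by have := (hVb v hv).2.1; omega)
    · rw [Finset.card_image_of_injective _ hw.injective, Finset.card_insert_of_notMem, hIcard]
      intro h
      have := I.le_max' _ h
      omega
    · intro x hx y hy hxy
      have h1 := hVb x hx
      have h2 := hVb y hy
      refine bdelta_eq_dseq hw le_rfl hxy fun l hl1 hl2 => hanti.antitoneOn ?_ ?_ hl1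
      · simp only [Finset.coe_Icc, Set.mem_Icc]
        omega
      · simp only [Finset.coe_Icc, Set.mem_Icc]
        omega
  push Not at hinc hdec
  have ht2 : 2 ≤ t := by
    by_contra hlt
    obtain rfl : t = 1 := by omega
    obtain ⟨i, hi1, hi2, hi3⟩ := hinc 0 (by omega)
    obtain ⟨j, hj1, hj2, hj3⟩ := hdec 0 (by omega)
    obtain rfl : i = 0 := by omega
    obtain rfl : j = 0 := by omega
    exact dseq_ne_dseq_succ hw 0 (le_antisymm hj3 hi3)
  obtain ⟨b, hbw, hb, hodd, heven⟩ := exists_alternating hw (k := k) ht2 hm.ge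
    (fun q hq => (hinc q hq).imp fun i h => ⟨h.1, h.2.1, not_lt.2 h.2.2⟩)
    (fun q hq => (hdec q hq).imp fun i h => ⟨h.1, h.2.1, not_lt.2 h.2.2⟩)
  have hbmono : ∀ i j, 1 ≤ i → i < j → j ≤ k + 1 → b i < b j := by
    intro i j h1 h2
    induction j, h2 using Nat.le_induction with
    | base => exact fun h => hb i h1 (by omega)
    | succ j hj ih => exact fun h => (ih (by omega)).trans (hb j (by omega) (by omega))
  have hbW : ∀ i, 1 ≤ i → i ≤ k + 1 → b i ∈ W := by
    intro i h1 h2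
    obtain ⟨l, hl, h⟩ := hbw i h1 h2
    exact h ▸ hmem l hl
  have hbi : Set.InjOn b (Finset.Icc 1 (k + 1)) := by
    intro i hi j hj hij
    simp only [Finset.coe_Icc, Set.mem_Icc] at hi hj
    rcases lt_trichotomy i j with h | h | h
    · exact absurd hij (hbmono i j hi.1 h hj.2).ne
    · exact h
    · exact absurd hij (hbmono j i hj.1 h hi.2).ne'
  refine ⟨(Finset.Icc 1 (k + 1)).image b, ?_, ?_, fun e he hcard => ?_⟩
  · intro x hx
    obtain ⟨i, hi, rfl⟩ := Finset.mem_image.1 hx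
    rw [Finset.mem_Icc] at hi
    exact hbW i hi.1 hi.2
  · rw [Finset.card_image_of_injOn hbi, Nat.card_Icc, Nat.add_sub_cancel]
  · obtain ⟨j, hj1, hj2, rfl⟩ := exists_eq_image_drop he hcard hbi
    rw [hE]
    · exact Or.inr (numExtrema_of_alternating hk hj1 hj2 hb hodd heven rfl)
    · intro i h1 h2
      split_ifs <;> first | omega | exact hbmono _ _ (by omega) (by omega) (by omega)
    · have h1 := Finset.mem_range.1 (hW (hbW k (by omega) (by omega)))
      have h2 := Finset.mem_range.1 (hW (hbW (k + 1) (by omega) (by omega)))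
      split_ifs
      · exact h1
      · exact h2
end
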